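/- arXiv:2510.14816 — 3 statements merged into one kernel-verified Lean document; each statement's English description precedes it below -/
import Mathlib

section
/- Let u, v, a, b be real numbers with u < v < 0 < a < b, let h(x) = (x − a)(x − b)(x − v), and let γ₂ = ((a + b + v) + √(a² + b² + v² − (ab + av + bv)))/3. If u < a + b + v − 2γ₂, then h(u) < h(γ₂). -/
/-- If `u < a + b + v - 2γ₂` then `h(u) < h(γ₂)` for the cubic `h(x) = (x-a)(x-b)(x-v)` with
local minimum point `γ₂`. -/
theorem cubic_value_at_u_lt (u v a b : ℝ) (h1 : u < v) (h2 : v < 0) (h3 : 0 < a) (h4 : a < b)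
    (h : ℝ → ℝ) (hh : h = fun x => (x - a) * (x - b) * (x - v))
    (γ₂ : ℝ)
    (hγ₂ : γ₂ = ((a + b + v) + Real.sqrt (a ^ 2 + b ^ 2 + v ^ 2 - (a * b + a * v + b * v))) / 3)
    (hu : u < a + b + v - 2 * γ₂) :
    h u < h γ₂ := by
  have hD : 0 ≤ a ^ 2 + b ^ 2 + v ^ 2 - (a * b + a * v + b * v) := by
    nlinarith [sq_nonneg (a - b), sq_nonneg (a - v), sq_nonneg (b - v)]
  have hs := Real.sq_sqrt hD
  have hn := Real.sqrt_nonneg (a ^ 2 + b ^ 2 + v ^ 2 - (a * b + a * v + b * v))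
  generalize Real.sqrt (a ^ 2 + b ^ 2 + v ^ 2 - (a * b + a * v + b * v)) = r at *
  have hr : r = 3 * γ₂ - (a + b + v) := by linarith
  have hlt : u < γ₂ := by linarith
  have hd : 3 * γ₂ ^ 2 - 2 * (a + b + v) * γ₂ + (a * b + a * v + b * v) = 0 := by
    rw [hr] at hs
    linarith
  have hp : 0 < (γ₂ - u) ^ 2 * ((a + b + v - 2 * γ₂) - u) :=
    mul_pos (pow_pos (sub_pos.2 hlt) 2) (sub_pos.2 hu)
  have key : h γ₂ - h u = (γ₂ - u) ^ 2 * ((a + b + v - 2 * γ₂) - u) := by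
    rw [hh]
    linear_combination (γ₂ - u) * hd
  linarith
end

section
/- Let u, v, a, b be real numbers with u < v < 0 < a < b, let h(x) = (x − a)(x − b)(x − v), and let γ₂ = ((a + b + v) + √(a² + b² + v² − (ab + av + bv)))/3. Assume u ≤ a + b + v − 2γ₂. Then for every x ∈ [u, v] ∪ [a, b], one has h(u) ≤ h(x) ≤ 0, and consequently the cubic f(x) = −2h(x)/h(u) + 1 satisfies −1 ≤ f(x) ≤ 1 for all x ∈ [u, v] ∪ [a, b] (note h(u) < 0). -/
/-- When `u ≤ a + b + v - 2γ₂`, the cubic `h(x) = (x-a)(x-b)(x-v)` satisfies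
`h(u) ≤ h(x) ≤ 0` on `[u,v] ∪ [a,b]`, so `f(x) = -2h(x)/h(u) + 1` maps `[u,v] ∪ [a,b]`
into `[-1, 1]` (note `h(u) < 0`). -/
theorem cubic_maps_spectrum_into_interval (u v a b : ℝ)
    (h1 : u < v) (h2 : v < 0) (h3 : 0 < a) (h4 : a < b)
    (h : ℝ → ℝ) (hh : h = fun x => (x - a) * (x - b) * (x - v))
    (γ₂ : ℝ)
    (hγ₂ : γ₂ = ((a + b + v) + Real.sqrt (a ^ 2 + b ^ 2 + v ^ 2 - (a * b + a * v + b * v))) / 3)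
    (hu : u ≤ a + b + v - 2 * γ₂)
    (f : ℝ → ℝ) (hf : f = fun x => -2 * h x / h u + 1) :
    h u < 0 ∧
    ∀ x ∈ Set.Icc u v ∪ Set.Icc a b,
      (h u ≤ h x ∧ h x ≤ 0) ∧ (-1 ≤ f x ∧ f x ≤ 1) := by
  have hD : 0 ≤ a ^ 2 + b ^ 2 + v ^ 2 - (a * b + a * v + b * v) := by
    nlinarith [sq_nonneg (a - b), sq_nonneg (a - v), sq_nonneg (b - v)]
  have hs0 := Real.sqrt_nonneg (a ^ 2 + b ^ 2 + v ^ 2 - (a * b + a * v + b * v))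
  have hs2 := Real.sq_sqrt hD
  generalize Real.sqrt (a ^ 2 + b ^ 2 + v ^ 2 - (a * b + a * v + b * v)) = s at *
  have hs : s = 3 * γ₂ - (a + b + v) := by linarith
  have hq : 3 * γ₂ ^ 2 - 2 * (a + b + v) * γ₂ + (a * b + a * v + b * v) = 0 := by
    rw [hs] at hs2
    linarith
  have hwa : b + v - 2 * a ≤ 2 * s := by
    exact abs_le_of_sq_le_sq' (by nlinarith [sq_nonneg (b - v)]) (by linarith) |>.2
  have hneg : h u < 0 := by
    rw [hh]
    exact mul_neg_of_pos_of_neg (mul_pos_of_neg_of_neg (by linarith) (by linarith)) (by linarith)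
  refine ⟨hneg, fun x hx => ?_⟩
  have key : h u ≤ h x ∧ h x ≤ 0 := by
    rcases hx with ⟨hx1, hx2⟩ | ⟨hx1, hx2⟩
    · have e1 : (a - x) * (b - x) ≤ (a - u) * (b - u) :=
        mul_le_mul (by linarith) (by linarith) (by linarith) (by linarith)
      have e0 : 0 ≤ (a - x) * (b - x) := mul_nonneg (by linarith) (by linarith)
      have e2 : (a - x) * (b - x) * (v - x) ≤ (a - u) * (b - u) * (v - u) :=
        mul_le_mul e1 (by linarith) (by linarith) (by linarith)
      have e3 := mul_nonneg e0 (sub_nonneg.2 hx2)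
      rw [hh]
      constructor
      · show (u - a) * (u - b) * (u - v) ≤ (x - a) * (x - b) * (x - v)
        linarith
      · show (x - a) * (x - b) * (x - v) ≤ 0
        linarith
    · have e : ∀ y, h y - h (a + b + v - 2 * γ₂)
          = (y - γ₂) ^ 2 * (y - (a + b + v - 2 * γ₂)) := by
        intro y
        simp only [hh]
        linear_combination (y - (a + b + v - 2 * γ₂)) * hq
      have e1 := e x
      have e2 := e u
      have p1 : 0 ≤ (x - γ₂) ^ 2 * (x - (a + b + v - 2 * γ₂)) :=
        mul_nonneg (sq_nonneg _) (by linarith)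
      have p2 : 0 ≤ (u - γ₂) ^ 2 * ((a + b + v - 2 * γ₂) - u) :=
        mul_nonneg (sq_nonneg _) (by linarith)
      refine ⟨by linarith, ?_⟩
      rw [hh]
      exact mul_nonpos_of_nonpos_of_nonneg
        (mul_nonpos_of_nonneg_of_nonpos (by linarith) (by linarith)) (by linarith)
  refine ⟨key, ?_⟩
  have r0 : 0 ≤ h x / h u := div_nonneg_of_nonpos key.2 hneg.le
  have r1 : h x / h u ≤ 1 := (div_le_one_of_neg hneg).2 key.1
  have r : f x = -2 * (h x / h u) + 1 := by
    rw [hf]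
    ring
  rw [r]
  constructor <;> linarith
end

section
/- Let u, v, a, b be real numbers with u < v < 0 < a < b, let h(x) = (x − a)(x − b)(x − v), let γ₂ = ((a + b + v) + √(a² + b² + v² − (ab + av + bv)))/3, assume u ≤ a + b + v − 2γ₂, and let f(x) = −2h(x)/h(u) + 1. Then for every natural number k and every x ∈ [u, v] ∪ [a, b], one has |T_k(f(x))| ≤ 1 ≤ T_k(f(0)), where T_k is the Chebyshev polynomial of the first kind of degree k; hence the shifted and scaled Chebyshev polynomial T_k(f(x))/T_k(f(0)) has absolute value at most 1/T_k(f(0)) on [u, v] ∪ [a, b]. -/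
/-- On `[u,v] ∪ [a,b]`, the composite shifted-and-scaled Chebyshev polynomial built from the
cubic `f(x) = -2h(x)/h(u) + 1` satisfies `|T_k(f(x))| ≤ 1 ≤ T_k(f(0))`, hence
`|T_k(f(x))/T_k(f(0))| ≤ 1/T_k(f(0))`. -/
theorem chebyshev_composite_bound (u v a b : ℝ)
    (h1 : u < v) (h2 : v < 0) (h3 : 0 < a) (h4 : a < b)
    (h : ℝ → ℝ) (hh : h = fun x => (x - a) * (x - b) * (x - v))
    (γ₂ : ℝ)
    (hγ₂ : γ₂ = ((a + b + v) + Real.sqrt (a ^ 2 + b ^ 2 + v ^ 2 - (a * b + a * v + b * v))) / 3)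
    (hu : u ≤ a + b + v - 2 * γ₂)
    (f : ℝ → ℝ) (hf : f = fun x => -2 * h x / h u + 1) :
    ∀ k : ℕ, ∀ x ∈ Set.Icc u v ∪ Set.Icc a b,
      |(Polynomial.Chebyshev.T ℝ k).eval (f x)| ≤ 1 ∧
      1 ≤ (Polynomial.Chebyshev.T ℝ k).eval (f 0) ∧
      |(Polynomial.Chebyshev.T ℝ k).eval (f x) / (Polynomial.Chebyshev.T ℝ k).eval (f 0)| ≤
        1 / (Polynomial.Chebyshev.T ℝ k).eval (f 0) := by
  set D := a ^ 2 + b ^ 2 + v ^ 2 - (a * b + a * v + b * v) with hD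
  have hDle : ((a + b) / 2 - v) ^ 2 ≤ D := by
    rw [hD]; nlinarith [sq_nonneg (a - b)]
  have hD0 : 0 ≤ D := le_trans (sq_nonneg _) hDle
  have hs : (a + b) / 2 - v ≤ Real.sqrt D := Real.le_sqrt_of_sq_le hDle
  have hsq : Real.sqrt D ^ 2 = D := Real.sq_sqrt hD0
  have hr : Real.sqrt D = 3 * γ₂ - (a + b + v) := by rw [hγ₂]; ring
  have hw : a + b + v - 2 * γ₂ ≤ v := by rw [hr] at hs; linarith
  have hcrit : 3 * γ₂ ^ 2 - 2 * (a + b + v) * γ₂ + (a * b + a * v + b * v) = 0 := by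
    rw [hr, hD] at hsq; linarith
  have key : ∀ x, h x - h γ₂ = (x - γ₂) ^ 2 * (x - (a + b + v - 2 * γ₂)) := by
    intro x
    rw [hh]
    linear_combination (x - γ₂) * hcrit
  have hneg : h u < 0 := by
    rw [hh]
    have := mul_pos (mul_pos (show 0 < a - u by linarith) (show 0 < b - u by linarith))
      (show 0 < v - u by linarith)
    show (u - a) * (u - b) * (u - v) < 0
    linarith
  have hzero : 0 < h 0 := by
    rw [hh]
    have := mul_pos (mul_pos h3 (h3.trans h4)) (neg_pos.2 h2)
    show 0 < (0 - a) * (0 - b) * (0 - v)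
    linarith
  have hugam : h u ≤ h γ₂ := by
    have := key u
    have := mul_nonneg (sq_nonneg (u - γ₂)) (sub_nonneg.2 hu)
    linarith
  intro k x hx
  have hrange : h u ≤ h x ∧ h x ≤ 0 := by
    rcases hx with ⟨hx1, hx2⟩ | ⟨hx1, hx2⟩
    · have e1 : (a - x) * (b - x) * (v - x) ≤ (a - u) * (b - u) * (v - u) := by
        have ha : 0 ≤ a - x := by linarith
        have hb : 0 ≤ b - x := by linarith
        have hv : 0 ≤ v - x := by linarith
        have ha' : 0 ≤ a - u := by linarith
        have hb' : 0 ≤ b - u := by linarith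
        gcongr
      have e2 := mul_nonneg (mul_nonneg (show 0 ≤ a - x by linarith)
        (show 0 ≤ b - x by linarith)) (show 0 ≤ v - x by linarith)
      rw [hh]
      constructor
      · show (u - a) * (u - b) * (u - v) ≤ (x - a) * (x - b) * (x - v)
        linarith
      · show (x - a) * (x - b) * (x - v) ≤ 0
        linarith
    · constructor
      · have := key x
        have := mul_nonneg (sq_nonneg (x - γ₂))
          (show 0 ≤ x - (a + b + v - 2 * γ₂) by linarith)
        linarith
      · have e2 := mul_nonneg (mul_nonneg (show 0 ≤ x - a by linarith)
          (show 0 ≤ b - x by linarith)) (show 0 ≤ x - v by linarith)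
        rw [hh]
        show (x - a) * (x - b) * (x - v) ≤ 0
        linarith
  have hfx : |f x| ≤ 1 := by
    have q1 : 0 ≤ h x / h u := div_nonneg_of_nonpos hrange.2 hneg.le
    have q2 : h x / h u ≤ 1 := (div_le_one_of_neg hneg).2 hrange.1
    have e : f x = -2 * (h x / h u) + 1 := by rw [hf]; ring
    rw [e, abs_le]
    constructor <;> linarith
  have hf0 : 1 ≤ f 0 := by
    have q1 : h 0 / h u < 0 := div_neg_of_pos_of_neg hzero hneg
    have e : f 0 = -2 * (h 0 / h u) + 1 := by rw [hf]; ring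
    rw [e]
    linarith
  have t1 := Polynomial.Chebyshev.abs_eval_T_real_le_one k hfx
  have t2 := Polynomial.Chebyshev.one_le_eval_T_real k hf0
  refine ⟨t1, t2, ?_⟩
  rw [abs_div, abs_of_pos (lt_of_lt_of_le one_pos t2)]
  exact div_le_div_of_nonneg_right t1 (by linarith)
end
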